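/- Let R be an admissible ring. Then Ŵ(N_R) is an ideal of W(R) stable under the Frobenius f and the Verschiebung v, and the Zink ring 𝕎(R) = {s(y) + z : y ∈ W(R_red), z ∈ Ŵ(N_R)} is a subring of W(R) which contains Ŵ(N_R) and satisfies f(𝕎(R)) ⊆ 𝕎(R). -/

import Mathlib

/-- A commutative ring `R` is *admissible* (for the prime `p`) if its
nilradical `N_R` is bounded nilpotent and `R_red = R/N_R` is a perfect ring of
characteristic `p`. -/
def IsAdmissible (p : ℕ) (R : Type*) [CommRing R] : Prop :=
  (∃ m : ℕ, 1 ≤ m ∧ ∀ x ∈ nilradical R, x ^ m = 0) ∧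
  (p : R ⧸ nilradical R) = 0 ∧
  Function.Bijective fun x : R ⧸ nilradical R => x ^ p

/-- `Ŵ(N_R)`: the set of Witt vectors all of whose coefficients are nilpotent
and all but finitely many are zero. -/
def hatW (p : ℕ) (R : Type*) [CommRing R] : Set (WittVector p R) :=
  {x | (∀ n, IsNilpotent (x.coeff n)) ∧ ∃ N, ∀ n ≥ N, x.coeff n = 0}

/-- The Zink ring `𝕎(R) = {s(y) + z : y ∈ W(R_red), z ∈ Ŵ(N_R)}`, as a subset
of `W(R)`, relative to a section `s : W(R_red) → W(R)`. -/
def zinkSet (p : ℕ) [Fact p.Prime] (R : Type*) [CommRing R]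
    (s : WittVector p (R ⧸ nilradical R) →+* WittVector p R) :
    Set (WittVector p R) :=
  {w | ∃ (y : WittVector p (R ⧸ nilradical R)) (z : WittVector p R),
        z ∈ hatW p R ∧ w = s y + z}

namespace MvPolynomial

/-- A weighted homogeneous polynomial whose degree is large compared to the nilpotency orders of
the values of the variables of positive weight vanishes at these values. -/
theorem IsWeightedHomogeneous.aeval_eq_zero {σ R : Type*} [CommRing R] {w : σ → ℕ} {D m : ℕ}
    {φ : MvPolynomial σ ℤ} (hφ : φ.IsWeightedHomogeneous w D) (x : σ → R) (T : Finset σ)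
    (hT : ∀ i ∉ T, w i ≠ 0 → x i = 0) (hm : ∀ i ∈ T, w i ≠ 0 → x i ^ m = 0)
    (hD : (∑ i ∈ T, w i) * m < D) : aeval x φ = 0 := by
  rw [aeval_def, eval₂_eq]
  refine Finset.sum_eq_zero fun d hd => ?_
  have hdeg : d.sum (fun i a => a * w i) = D := by
    simpa [Finsupp.weight_apply] using hφ (mem_support_iff.mp hd)
  suffices h : ∃ i ∈ d.support, x i ^ d i = 0 by
    obtain ⟨i, hi, h0⟩ := h
    rw [Finset.prod_eq_zero hi h0, mul_zero]
  by_contra! hne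
  refine hD.not_ge ?_
  rw [← hdeg, Finsupp.sum, Finset.sum_mul]
  calc ∑ i ∈ d.support, d i * w i ≤ ∑ i ∈ d.support with w i ≠ 0, w i * m := by
        rw [Finset.sum_filter]
        refine Finset.sum_le_sum fun i hi => ?_
        split_ifs with hw
        · by_cases hiT : i ∈ T
          · rw [mul_comm]
            refine Nat.mul_le_mul_left _ (le_of_not_ge fun hle => hne i hi ?_)
            exact pow_eq_zero_of_le hle (hm i hiT hw)
          · exact absurd (by rw [hT i hiT hw, zero_pow (Finsupp.mem_support_iff.mp hi)]) (hne i hi)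
        · simp [not_not.mp hw]
    _ ≤ ∑ i ∈ T, w i * m := by
        refine Finset.sum_le_sum_of_subset fun i hi => ?_
        obtain ⟨hi, hw⟩ := Finset.mem_filter.mp hi
        by_contra hiT
        exact hne i hi (by rw [hT i hiT hw, zero_pow (Finsupp.mem_support_iff.mp hi)])

theorem IsWeightedHomogeneous.of_map {σ R S : Type*} [CommSemiring R] [CommSemiring S]
    {w : σ → ℕ} {D : ℕ} {f : R →+* S} (hf : Function.Injective f) {φ : MvPolynomial σ R}
    (h : (map f φ).IsWeightedHomogeneous w D) : φ.IsWeightedHomogeneous w D := by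
  intro d hd
  refine h ?_
  rw [coeff_map]
  exact (map_ne_zero_iff f hf).mpr hd

variable {p : ℕ} {σ : Type*} {w : σ → ℕ}

theorem isWeightedHomogeneous_rename_wittPolynomial {e : ℕ → σ} {c : ℕ}
    (he : ∀ j, w (e j) = c * p ^ j) (n : ℕ) :
    (rename e (wittPolynomial p ℚ n)).IsWeightedHomogeneous w (c * p ^ n) := by
  rw [wittPolynomial_eq_sum_C_mul_X_pow, map_sum]
  refine IsWeightedHomogeneous.sum _ _ _ fun i hi => ?_
  rw [map_mul, rename_C, map_pow (rename e), rename_X]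
  have h := ((isWeightedHomogeneous_X ℚ w (e i)).pow (p ^ (n - i))).C_mul ((p : ℚ) ^ i)
  have hin : i ≤ n := Nat.lt_succ_iff.mp (Finset.mem_range.mp hi)
  rwa [he, smul_eq_mul, mul_left_comm, ← pow_add, Nat.sub_add_cancel hin] at h

theorem isWeightedHomogeneous_bind₁_xInTermsOfW [Fact p.Prime] {g : ℕ → MvPolynomial σ ℚ} {c : ℕ}
    (hg : ∀ k, (g k).IsWeightedHomogeneous w (c * p ^ k)) (n : ℕ) :
    (bind₁ g (xInTermsOfW p ℚ n)).IsWeightedHomogeneous w (c * p ^ n) := by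
  induction n using Nat.strong_induction_on with | h n ih => ?_
  rw [xInTermsOfW_eq, mul_comm, map_mul, map_sub, map_sum, algHom_C, algebraMap_eq, bind₁_X_right]
  refine ((hg n).sub (IsWeightedHomogeneous.sum _ _ _ fun i hi => ?_)).C_mul _
  rw [map_mul, algHom_C, algebraMap_eq, map_pow (bind₁ g)]
  have hin := Finset.mem_range.mp hi
  have h := ((ih i hin).pow (p ^ (n - i))).C_mul ((p : ℚ) ^ i)
  rwa [smul_eq_mul, mul_left_comm, ← pow_add, Nat.sub_add_cancel hin.le] at h

end MvPolynomial

namespace WittVector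

open MvPolynomial

variable {p : ℕ} [hp : Fact p.Prime] {R : Type*} [CommRing R]

theorem isWeightedHomogeneous_wittAdd (n : ℕ) :
    (wittAdd p n).IsWeightedHomogeneous (fun i : Fin 2 × ℕ => p ^ i.2) (p ^ n) := by
  refine IsWeightedHomogeneous.of_map (Int.castRingHom ℚ).injective_int ?_
  rw [wittAdd, map_wittStructureInt, wittStructureRat, ← one_mul (p ^ n)]
  refine isWeightedHomogeneous_bind₁_xInTermsOfW (fun k => ?_) n
  simp only [map_add, map_X, bind₁_X_right]
  exact (isWeightedHomogeneous_rename_wittPolynomial (by simp) k).add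
    (isWeightedHomogeneous_rename_wittPolynomial (by simp) k)

theorem isWeightedHomogeneous_wittMul (n : ℕ) :
    (wittMul p n).IsWeightedHomogeneous
      (fun i : Fin 2 × ℕ => (i.1 : ℕ) * p ^ i.2) (p ^ n) := by
  refine IsWeightedHomogeneous.of_map (Int.castRingHom ℚ).injective_int ?_
  rw [wittMul, map_wittStructureInt, wittStructureRat, ← one_mul (p ^ n)]
  refine isWeightedHomogeneous_bind₁_xInTermsOfW (fun k => ?_) n
  simp only [map_mul, map_X, bind₁_X_right]
  have h := (isWeightedHomogeneous_rename_wittPolynomial (p := p)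
    (w := fun i : Fin 2 × ℕ => (i.1 : ℕ) * p ^ i.2) (e := Prod.mk 0) (c := 0) (by simp) k).mul
    (isWeightedHomogeneous_rename_wittPolynomial (p := p) (e := Prod.mk 1) (c := 1) (by simp) k)
  rwa [zero_mul, zero_add] at h

theorem isWeightedHomogeneous_frobeniusPoly (n : ℕ) :
    (frobeniusPoly p n).IsWeightedHomogeneous (fun i => p ^ i) (p * p ^ n) := by
  refine IsWeightedHomogeneous.of_map (Int.castRingHom ℚ).injective_int ?_
  rw [map_frobeniusPoly, frobeniusPolyRat]
  refine isWeightedHomogeneous_bind₁_xInTermsOfW (fun k => ?_) n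
  have h := isWeightedHomogeneous_rename_wittPolynomial (p := p) (w := fun i => p ^ i) (e := id)
    (c := 1) (by simp) (k + 1)
  rwa [rename_id_apply, one_mul, pow_succ'] at h

theorem map_mk_nilradical_eq_zero_iff {x : WittVector p R} :
    map (Ideal.Quotient.mk (nilradical R)) x = 0 ↔ ∀ n, IsNilpotent (x.coeff n) := by
  simp only [WittVector.ext_iff, map_coeff, zero_coeff, Ideal.Quotient.eq_zero_iff_mem,
    mem_nilradical]

theorem map_mk_nilradical_eq_zero {x : WittVector p R} (hx : x ∈ hatW p R) :
    map (Ideal.Quotient.mk (nilradical R)) x = 0 :=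
  map_mk_nilradical_eq_zero_iff.mpr hx.1

theorem zero_mem_hatW : (0 : WittVector p R) ∈ hatW p R :=
  ⟨fun n => by simp, 0, fun n _ => by simp⟩

theorem verschiebung_mem_hatW {x : WittVector p R} (hx : x ∈ hatW p R) :
    verschiebung x ∈ hatW p R := by
  obtain ⟨h, N, hN⟩ := hx
  refine ⟨fun n => ?_, N + 1, fun n hn => ?_⟩
  · cases n <;> simp [h]
  · obtain ⟨n, rfl⟩ : ∃ k, n = k + 1 := ⟨n - 1, by omega⟩
    rw [verschiebung_coeff_add_one, hN n (by omega)]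

section BoundedNil

variable {m : ℕ} (hm : ∀ x ∈ nilradical R, x ^ m = 0)

include hm

theorem add_mem_hatW {x y : WittVector p R} (hx : x ∈ hatW p R) (hy : y ∈ hatW p R) :
    x + y ∈ hatW p R := by
  refine ⟨map_mk_nilradical_eq_zero_iff.mp ?_, ?_⟩
  · rw [map_add, map_mk_nilradical_eq_zero hx, map_mk_nilradical_eq_zero hy, add_zero]
  obtain ⟨hx, M, hM⟩ := hx
  obtain ⟨hy, N, hN⟩ := hy
  let T : Finset (Fin 2 × ℕ) := Finset.univ ×ˢ Finset.range (max M N)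
  refine ⟨(∑ i ∈ T, p ^ i.2) * m + 1, fun n hn => ?_⟩
  rw [add_coeff, peval]
  refine (isWeightedHomogeneous_wittAdd n).aeval_eq_zero _ T ?_ ?_
    ((Nat.lt_of_succ_le hn).trans (Nat.lt_pow_self hp.out.one_lt))
  · rintro ⟨i, j⟩ hij -
    have hj : max M N ≤ j := by simpa [T] using hij
    fin_cases i
    · exact hM j (le_of_max_le_left hj)
    · exact hN j (le_of_max_le_right hj)
  · rintro ⟨i, j⟩ - -
    fin_cases i
    · exact hm _ (hx j)
    · exact hm _ (hy j)

theorem mul_mem_hatW (x : WittVector p R) {y : WittVector p R} (hy : y ∈ hatW p R) :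
    x * y ∈ hatW p R := by
  refine ⟨map_mk_nilradical_eq_zero_iff.mp ?_, ?_⟩
  · rw [map_mul, map_mk_nilradical_eq_zero hy, mul_zero]
  obtain ⟨hy, N, hN⟩ := hy
  let T : Finset (Fin 2 × ℕ) := Finset.univ ×ˢ Finset.range N
  refine ⟨(∑ i ∈ T, (i.1 : ℕ) * p ^ i.2) * m + 1, fun n hn => ?_⟩
  rw [mul_coeff, peval]
  refine (isWeightedHomogeneous_wittMul n).aeval_eq_zero _ T ?_ ?_
    ((Nat.lt_of_succ_le hn).trans (Nat.lt_pow_self hp.out.one_lt))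
  · rintro ⟨i, j⟩ hij hw
    have hj : N ≤ j := by simpa [T] using hij
    fin_cases i
    · simp at hw
    · exact hN j hj
  · rintro ⟨i, j⟩ - hw
    fin_cases i
    · simp at hw
    · exact hm _ (hy j)

theorem frobenius_mem_hatW {x : WittVector p R} (hx : x ∈ hatW p R) :
    frobenius x ∈ hatW p R := by
  refine ⟨map_mk_nilradical_eq_zero_iff.mp ?_, ?_⟩
  · rw [(frobenius_isPoly p).map, map_mk_nilradical_eq_zero hx, map_zero]
  obtain ⟨hx, N, hN⟩ := hx
  refine ⟨(∑ i ∈ Finset.range N, p ^ i) * m + 1, fun n hn => ?_⟩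
  rw [coeff_frobenius]
  refine (isWeightedHomogeneous_frobeniusPoly n).aeval_eq_zero _ (Finset.range N) ?_ ?_
    ((Nat.lt_of_succ_le hn).trans ((Nat.lt_pow_self hp.out.one_lt).trans_le
      (Nat.le_mul_of_pos_left _ hp.out.pos)))
  · exact fun i hi _ => hN i (by simpa using hi)
  · exact fun i _ _ => hm _ (hx i)

variable (p) in
/-- `Ŵ(N_R)` as an ideal of `W(R)`. -/
def hatWIdeal : Ideal (WittVector p R) where
  carrier := hatW p R
  add_mem' := add_mem_hatW hm
  zero_mem' := zero_mem_hatW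
  smul_mem' x _ hy := mul_mem_hatW hm x hy

end BoundedNil

theorem exists_eq_teichmuller_add_verschiebung (x : WittVector p R) :
    ∃ y, x = teichmuller p (x.coeff 0) + verschiebung y := by
  refine ⟨mk p fun n => x.coeff (n + 1), ?_⟩
  ext n
  rw [coeff_add_of_disjoint]
  · cases n with
    | zero => simp [teichmuller_coeff_zero]
    | succ n => simp [teichmuller_coeff_pos, coeff_mk]
  · rintro (_ | n)
    · exact Or.inr rfl
    · exact Or.inl rfl

theorem verschiebung_mul_verschiebung (x y : WittVector p R) :
    verschiebung x * verschiebung y = p * verschiebung (x * y) := by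
  rw [← verschiebung_mul_frobenius, frobenius_verschiebung, ← mul_assoc,
    mul_comm _ (p : WittVector p R), ← nsmul_eq_mul, map_nsmul, nsmul_eq_mul]

theorem dvd_pow_sub_teichmuller_pow (x : WittVector p R) :
    (p : WittVector p R) ∣ x ^ p - teichmuller p (x.coeff 0) ^ p := by
  obtain ⟨y, hy⟩ := exists_eq_teichmuller_add_verschiebung x
  obtain ⟨r, hr⟩ := exists_add_pow_prime_pow_eq hp.out
    (teichmuller p (x.coeff 0)) (verschiebung y) 1
  rw [pow_one, ← hy] at hr
  have h2 : (p : WittVector p R) ∣ verschiebung y ^ p :=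
    Dvd.dvd.trans ⟨_, (sq _).trans (verschiebung_mul_verschiebung y y)⟩
      (pow_dvd_pow _ hp.out.two_le)
  have h : x ^ p - teichmuller p (x.coeff 0) ^ p = verschiebung y ^ p +
      p * (teichmuller p (x.coeff 0) * verschiebung y * r) := by
    rw [hr]; ring
  rw [h]
  exact dvd_add h2 (dvd_mul_right _ _)

theorem dvd_pow_prime_pow {x : WittVector p R} {b : ℕ} (hx : x.coeff 0 ^ b = 0) :
    (p : WittVector p R) ∣ x ^ p ^ (b + 1) := by
  have h1 := (dvd_pow_sub_teichmuller_pow x).trans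
    (sub_dvd_pow_sub_pow (x ^ p) (teichmuller p (x.coeff 0) ^ p) (p ^ b))
  rw [← pow_mul, ← pow_mul, ← pow_succ', ← map_pow, pow_eq_zero_of_le
    ((Nat.lt_pow_self hp.out.one_lt).le.trans (Nat.pow_le_pow_right hp.out.pos b.le_succ)) hx,
    teichmuller_zero, sub_zero] at h1
  exact h1

/-- The `p`-adic topology on `W(R)` is separated if `p` is nilpotent in `R`. -/
theorem eq_zero_of_forall_pow_dvd (hpR : IsNilpotent (p : R)) {x : WittVector p R}
    (hx : ∀ j, (p : WittVector p R) ^ j ∣ x) : x = 0 := by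
  obtain ⟨K, hK⟩ := hpR
  obtain ⟨a, ha⟩ := exists_eq_teichmuller_add_verschiebung ((p : WittVector p R) ^ K)
  have h0 : ((p : WittVector p R) ^ K).coeff 0 = 0 := by
    change constantCoeff ((p : WittVector p R) ^ K) = 0
    rw [map_pow, map_natCast, hK]
  rw [h0, teichmuller_zero, zero_add] at ha
  have key : ∀ j (y : WittVector p R), ∃ z,
      ((p : WittVector p R) ^ K) ^ j * y = verschiebung^[j] z := by
    intro j
    induction j with
    | zero => exact fun y => ⟨y, by simp⟩
    | succ j ih =>
      intro y
      obtain ⟨z, hz⟩ := ih (a * frobenius y)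
      refine ⟨z, ?_⟩
      rw [Function.iterate_succ_apply', ← hz, pow_succ, mul_assoc]
      nth_rw 2 [ha]
      rw [← verschiebung_mul_frobenius]
      have : ((p : WittVector p R) ^ K) ^ j = ((p ^ K) ^ j : ℕ) := by push_cast; rfl
      rw [this, ← nsmul_eq_mul, ← nsmul_eq_mul, map_nsmul]
  ext n
  obtain ⟨y, hy⟩ := hx (K * (n + 1))
  obtain ⟨z, hz⟩ := key (n + 1) y
  rw [hy, pow_mul, hz, iterate_verschiebung_coeff_eq_zero z n.lt_succ_self, zero_coeff]

/-- Two lifts to `W(R)` of the same ring homomorphism `W(k) → W(R_red)`, for `k` perfect, agree. -/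
theorem eq_of_map_comp_eq {k : Type*} [CommRing k] [CharP k p] [PerfectRing k p] {m : ℕ}
    (hm : ∀ x ∈ nilradical R, x ^ m = 0) (hpR : IsNilpotent (p : R))
    {g h : WittVector p k →+* WittVector p R}
    (hgh : (map (Ideal.Quotient.mk (nilradical R))).comp g =
      (map (Ideal.Quotient.mk (nilradical R))).comp h) : g = h := by
  have hnil (x) : (p : WittVector p R) ∣ (g x - h x) ^ p ^ (m + 1) := by
    refine dvd_pow_prime_pow (hm _ ?_)
    refine map_mk_nilradical_eq_zero_iff.mp ?_ 0
    rw [map_sub, sub_eq_zero]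
    exact RingHom.congr_fun hgh x
  have hfrob (x) : (p : WittVector p R) ∣ g x ^ p ^ (m + 1) - h x ^ p ^ (m + 1) := by
    obtain ⟨r, hr⟩ := exists_add_pow_prime_pow_eq hp.out (g x - h x) (h x) (m + 1)
    rw [sub_add_cancel] at hr
    have : g x ^ p ^ (m + 1) - h x ^ p ^ (m + 1) =
        (g x - h x) ^ p ^ (m + 1) + p * ((g x - h x) * h x * r) := by
      rw [hr]; ring
    rw [this]
    exact dvd_add (hnil x) (dvd_mul_right _ _)
  have hteich (j : ℕ) (a : k) :
      (p : WittVector p R) ^ j ∣ g (teichmuller p a) - h (teichmuller p a) := by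
    obtain ⟨b, rfl⟩ := (iterateFrobeniusEquiv k p (m + 1 + j)).surjective a
    have := dvd_sub_pow_of_dvd_sub (hfrob (teichmuller p b)) j
    rw [iterateFrobeniusEquiv_def, pow_add, pow_mul, map_pow, map_pow, map_pow, map_pow, map_pow,
      map_pow]
    exact (pow_dvd_pow _ j.le_succ).trans this
  ext1 x
  rw [← sub_eq_zero]
  refine eq_zero_of_forall_pow_dvd hpR fun j => ?_
  rw [← Ideal.mem_span_singleton, ← Ideal.Quotient.eq]
  refine RingHom.congr_fun (eq_of_apply_teichmuller_eq
    ((Ideal.Quotient.mk (Ideal.span {(p : WittVector p R) ^ j})).comp g)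
    ((Ideal.Quotient.mk _).comp h) ⟨j, ?_⟩ fun a => ?_) x
  · rw [← map_natCast (Ideal.Quotient.mk _), ← map_pow]
    exact Ideal.Quotient.eq_zero_iff_mem.mpr (Ideal.mem_span_singleton_self _)
  · exact Ideal.Quotient.eq.mpr (Ideal.mem_span_singleton.mpr (hteich j a))

theorem frobenius_comp_section (hR : IsAdmissible p R)
    {s : WittVector p (R ⧸ nilradical R) →+* WittVector p R}
    (hs : (map (Ideal.Quotient.mk (nilradical R))).comp s = RingHom.id _) :
    frobenius.comp s = s.comp frobenius := by
  rcases subsingleton_or_nontrivial R with _ | _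
  · ext x n
    exact Subsingleton.elim _ _
  obtain ⟨⟨m, -, hm⟩, hpk, hperf⟩ := hR
  have : Nontrivial (R ⧸ nilradical R) := Ideal.Quotient.nontrivial_iff.mpr fun h =>
    not_isNilpotent_one (R := R) (mem_nilradical.mp (h ▸ Submodule.mem_top))
  have : CharP (R ⧸ nilradical R) p :=
    (CharP.charP_iff_prime_eq_zero hp.out).mpr hpk
  have : PerfectRing (R ⧸ nilradical R) p := ⟨hperf⟩
  have hpR : IsNilpotent (p : R) := by
    rw [← mem_nilradical, ← Ideal.Quotient.eq_zero_iff_mem, map_natCast, hpk]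
  have hs' (x) : map (Ideal.Quotient.mk (nilradical R)) (s x) = x := RingHom.congr_fun hs x
  refine eq_of_map_comp_eq hm hpR (RingHom.ext fun x => ?_)
  simp only [RingHom.comp_apply, (frobenius_isPoly p).map, hs']

end WittVector

/-- For an admissible ring `R`, `Ŵ(N_R)` is an ideal of `W(R)`
stable under Frobenius and Verschiebung, and the Zink ring `𝕎(R)` is a subring
of `W(R)` containing `Ŵ(N_R)` and stable under Frobenius. -/
theorem zinkSet_subring_and_hatW_ideal (p : ℕ) [Fact p.Prime]
    (R : Type*) [CommRing R] (hR : IsAdmissible p R)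
    (s : WittVector p (R ⧸ nilradical R) →+* WittVector p R)
    (hs : (WittVector.map (Ideal.Quotient.mk (nilradical R))).comp s = RingHom.id _) :
    (∃ I : Ideal (WittVector p R), (I : Set (WittVector p R)) = hatW p R) ∧
    (∀ x ∈ hatW p R, WittVector.frobenius x ∈ hatW p R) ∧
    (∀ x ∈ hatW p R, WittVector.verschiebung x ∈ hatW p R) ∧
    (∃ S : Subring (WittVector p R), (S : Set (WittVector p R)) = zinkSet p R s) ∧
    hatW p R ⊆ zinkSet p R s ∧
    (∀ x ∈ zinkSet p R s, WittVector.frobenius x ∈ zinkSet p R s) := by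
  have hfrob := WittVector.frobenius_comp_section hR hs
  obtain ⟨⟨m, -, hm⟩, -, -⟩ := hR
  let I := WittVector.hatWIdeal p hm
  refine ⟨⟨I, rfl⟩, fun x => WittVector.frobenius_mem_hatW hm,
    fun x => WittVector.verschiebung_mem_hatW, ?_, fun z hz => ⟨0, z, hz, by simp⟩, ?_⟩
  · refine ⟨((Ideal.Quotient.mk I).comp s).range.comap (Ideal.Quotient.mk I), ?_⟩
    ext w
    refine exists_congr fun y => ⟨fun h => ⟨w - s y, Ideal.Quotient.eq.mp h.symm, by ring⟩, ?_⟩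
    rintro ⟨z, hz, rfl⟩
    refine (Ideal.Quotient.eq.mpr ?_).symm
    rwa [add_sub_cancel_left]
  · rintro _ ⟨y, z, hz, rfl⟩
    refine ⟨WittVector.frobenius y, WittVector.frobenius z,
      WittVector.frobenius_mem_hatW hm hz, ?_⟩
    rw [map_add]
    exact congrArg (· + _) (RingHom.congr_fun hfrob y)
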